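/- Let 0 < α < 1, 0 < β < 1, μ_1 > 0 and μ_2 > 0. Let X and Y be independent ℕ-valued random variables with P(X = n) = (μ_1^n/n!) Σ_{r=0}^{∞} ((n+r)!/r!) (−μ_1)^r / Γ(α(n+r)+1) and P(Y = n) = (μ_2^n/n!) Σ_{r=0}^{∞} ((n+r)!/r!) (−μ_2)^r / Γ(β(n+r)+1) for all n ∈ ℕ. Then for every integer n ≥ 0, P(X − Y = n) = μ_1^n Σ_{r_1=0}^{∞} Σ_{r_2=0}^{∞} ((−μ_1)^{r_1} (−μ_2)^{r_2} / (r_1! r_2!)) Σ_{m=0}^{∞} [ Γ(n+r_1+1+m) Γ(r_2+1+m) / ( Γ(α(n+r_1+m)+1) Γ(β(r_2+m)+1) Γ(n+1+m) ) ] (μ_1 μ_2)^m / m!. -/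

import Mathlib

open MeasureTheory ProbabilityTheory Real

/-- `X` has the distribution of a fractional Poisson random variable of order `α`
with parameter `μ`. -/
def IsFractionalPoisson {Ω : Type*} [MeasurableSpace Ω] (P : Measure Ω)
    (α μ : ℝ) (X : Ω → ℕ) : Prop :=
  ∀ n : ℕ, P {ω | X ω = n}
    = ENNReal.ofReal ((μ ^ n / n.factorial) *
        ∑' r : ℕ, (((n + r).factorial : ℝ) / (r.factorial : ℝ)) * (-μ) ^ r /
          Real.Gamma (α * (n + r) + 1))

theorem rpow_mul_exp_neg_le_Gamma_add_one {s y : ℝ} (hs : 0 ≤ s) (hy : 0 ≤ y) :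
    y ^ s * exp (-y) ≤ Gamma (s + 1) := by
  have hint : IntegrableOn (fun x => exp (-x) * x ^ s) (Set.Ioi 0) := by
    simpa using GammaIntegral_convergent (s := s + 1) (by positivity)
  have hsub : Set.Ioi y ⊆ Set.Ioi 0 := Set.Ioi_subset_Ioi hy
  rw [Gamma_eq_integral (by positivity), add_sub_cancel_right, ← integral_exp_neg_Ioi,
    ← integral_const_mul]
  calc ∫ x in Set.Ioi y, y ^ s * exp (-x)
      ≤ ∫ x in Set.Ioi y, exp (-x) * x ^ s := by
        refine setIntegral_mono_on ((integrableOn_exp_neg_Ioi y).const_mul _)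
          (hint.mono_set hsub) measurableSet_Ioi fun x hx => ?_
        rw [mul_comm]
        gcongr
        exact (Set.mem_Ioi.1 hx).le
    _ ≤ ∫ x in Set.Ioi 0, exp (-x) * x ^ s := by
        refine setIntegral_mono_set hint ?_ (Filter.Eventually.of_forall hsub)
        filter_upwards [ae_restrict_mem measurableSet_Ioi] with x hx
        have : 0 < x := hx
        simp only [Pi.zero_apply]
        positivity

/-- The reciprocals `1 / Γ(α k + 1)` decay faster than any geometric sequence. -/
theorem exists_inv_Gamma_le_mul_pow {α ε : ℝ} (hα : 0 < α) (hε : 0 < ε) :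
    ∃ C : ℝ, 0 ≤ C ∧ ∀ k : ℕ, (Gamma (α * k + 1))⁻¹ ≤ C * ε ^ k := by
  refine ⟨exp (ε⁻¹ ^ α⁻¹), (exp_pos _).le, fun k => ?_⟩
  have h := rpow_mul_exp_neg_le_Gamma_add_one (s := α * k) (y := ε⁻¹ ^ α⁻¹)
    (by positivity) (by positivity)
  rw [← rpow_mul (by positivity), inv_mul_cancel_left₀ hα.ne', rpow_natCast] at h
  refine (inv_anti₀ (by positivity) h).trans_eq ?_
  rw [mul_inv, inv_pow, inv_inv, exp_neg, inv_inv, mul_comm]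

/-- The general term of the double series whose row sums are the point probabilities of the
fractional Poisson distribution. -/
noncomputable def fractionalPoissonTerm (α μ : ℝ) (j r : ℕ) : ℝ :=
  (j + r).choose j * μ ^ j * (-μ) ^ r / Gamma (α * (j + r) + 1)

theorem IsFractionalPoisson.measure_eq {Ω : Type*} [MeasurableSpace Ω] {P : Measure Ω}
    {α μ : ℝ} {X : Ω → ℕ} (hX : IsFractionalPoisson P α μ X) (n : ℕ) :
    P {ω | X ω = n} = ENNReal.ofReal (∑' r, fractionalPoissonTerm α μ n r) := by
  rw [hX n, ← tsum_mul_left]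
  congr! 3 with r
  rw [fractionalPoissonTerm, ← Nat.add_choose_mul_factorial_mul_factorial,
    Nat.choose_symm_add]
  push_cast
  field_simp

theorem exists_abs_fractionalPoissonTerm_le {α μ : ℝ} (hα : 0 < α) (hμ : 0 < μ) :
    ∃ C : ℝ, 0 ≤ C ∧ ∀ j r : ℕ,
      |fractionalPoissonTerm α μ j r| ≤ C * ((1 / 2) ^ j * (1 / 2) ^ r) := by
  obtain ⟨C, hC, h⟩ := exists_inv_Gamma_le_mul_pow hα (ε := 1 / (4 * μ)) (by positivity)
  refine ⟨C, hC, fun j r => ?_⟩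
  have hΓ : 0 < Gamma (α * (j + r) + 1) := Gamma_pos_of_pos (by positivity)
  have hch : ((j + r).choose j : ℝ) ≤ 2 ^ (j + r) := mod_cast Nat.choose_le_two_pow _ _
  have hk := h (j + r)
  push_cast at hk
  rw [fractionalPoissonTerm, div_eq_mul_inv, abs_mul, abs_mul, abs_mul, abs_pow, abs_pow,
    abs_neg, abs_of_pos hμ, abs_of_pos (inv_pos.2 hΓ), Nat.abs_cast]
  calc ((j + r).choose j : ℝ) * μ ^ j * μ ^ r * (Gamma (α * (j + r) + 1))⁻¹
      ≤ 2 ^ (j + r) * μ ^ j * μ ^ r * (C * (1 / (4 * μ)) ^ (j + r)) := by gcongr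
    _ = C * (2 * μ * (1 / (4 * μ))) ^ (j + r) := by rw [mul_pow, mul_pow, pow_add μ]; ring
    _ = C * ((1 / 2) ^ j * (1 / 2) ^ r) := by
        rw [← pow_add]
        congr 2
        field_simp
        norm_num

theorem summable_geometric_two_mul :
    Summable fun p : ℕ × ℕ => ((1 : ℝ) / 2) ^ p.1 * (1 / 2) ^ p.2 :=
  summable_geometric_two.mul_of_nonneg summable_geometric_two
    (fun _ => by positivity) (fun _ => by positivity)

theorem summable_fractionalPoissonTerm {α μ : ℝ} (hα : 0 < α) (hμ : 0 < μ) :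
    Summable fun p : ℕ × ℕ => fractionalPoissonTerm α μ p.1 p.2 := by
  obtain ⟨C, -, h⟩ := exists_abs_fractionalPoissonTerm_le hα hμ
  exact (summable_geometric_two_mul.mul_left C).of_norm_bounded fun p => h p.1 p.2

theorem sum_antidiagonal_fractionalPoissonTerm (α μ : ℝ) (k : ℕ) :
    ∑ p ∈ Finset.HasAntidiagonal.antidiagonal k, fractionalPoissonTerm α μ p.1 p.2 = if k = 0 then 1 else 0 := by
  have h : ∑ p ∈ Finset.HasAntidiagonal.antidiagonal k, fractionalPoissonTerm α μ p.1 p.2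
      = (μ + -μ) ^ k / Gamma (α * k + 1) := by
    rw [(Commute.all μ (-μ)).add_pow', Finset.sum_div]
    refine Finset.sum_congr rfl fun p hp => ?_
    rw [← Finset.HasAntidiagonal.mem_antidiagonal.1 hp, fractionalPoissonTerm, nsmul_eq_mul, Nat.cast_add, mul_assoc]
  rw [h]
  split_ifs with hk <;> simp [hk]

theorem hasSum_fractionalPoissonTerm {α μ : ℝ} (hα : 0 < α) (hμ : 0 < μ) :
    HasSum (fun p : ℕ × ℕ => fractionalPoissonTerm α μ p.1 p.2) 1 := by
  have hs := summable_fractionalPoissonTerm hα hμ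
  have hσ := (Finset.HasAntidiagonal.sigmaAntidiagonalEquivProd (A := ℕ)).hasSum_iff.2 hs.hasSum
  have hk := hσ.sigma fun k => Finset.hasSum (Finset.HasAntidiagonal.antidiagonal k)
    fun p => fractionalPoissonTerm α μ p.1 p.2
  simp only [sum_antidiagonal_fractionalPoissonTerm] at hk
  rw [← hk.unique (hasSum_ite_eq 0 1)]
  exact hs.hasSum

/-- If the positive parts of a summable real family have the same total as the family itself,
then the family is nonnegative. -/
theorem nonneg_of_tsum_ofReal_eq {ι : Type*} {f : ι → ℝ} {a : ℝ} (ha : 0 ≤ a) (hf : HasSum f a)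
    (h : ∑' i, ENNReal.ofReal (f i) = ENNReal.ofReal a) (i : ι) : 0 ≤ f i := by
  have hs : Summable fun i => max (f i) 0 :=
    hf.summable.abs.of_nonneg_of_le (fun _ => le_max_right _ _)
      fun i => max_le (le_abs_self _) (abs_nonneg _)
  have hsum : ∑' i, max (f i) 0 = a := by
    rw [← ENNReal.ofReal_eq_ofReal_iff (tsum_nonneg fun _ => le_max_right _ _) ha, ← h,
      ENNReal.ofReal_tsum_of_nonneg (fun _ => le_max_right _ _) hs]
    simp
  have hd : HasSum (fun i => max (f i) 0 - f i) 0 := by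
    simpa [hsum] using hs.hasSum.sub hf
  have hz := congrFun ((hasSum_zero_iff_of_nonneg fun i => sub_nonneg.2 (le_max_left _ _)).1 hd) i
  rw [← sub_eq_zero.1 hz]
  exact le_max_right _ _

theorem tsum_measure_eq_one {Ω : Type*} [MeasurableSpace Ω] {P : Measure Ω}
    [IsProbabilityMeasure P] {X : Ω → ℕ} (hX : Measurable X) :
    ∑' n, P {ω | X ω = n} = 1 := by
  have := tsum_measure_preimage_singleton (μ := P) (Set.countable_univ (α := ℕ)) (f := X)
    fun y _ => hX (measurableSet_singleton y)
  rwa [tsum_univ fun n => P (X ⁻¹' {n}), Set.preimage_univ, measure_univ] at this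

theorem IsFractionalPoisson.tsum_nonneg {Ω : Type*} [MeasurableSpace Ω] {P : Measure Ω}
    [IsProbabilityMeasure P] {α μ : ℝ} (hα : 0 < α) (hμ : 0 < μ) {X : Ω → ℕ}
    (hXmeas : Measurable X) (hX : IsFractionalPoisson P α μ X) (n : ℕ) :
    0 ≤ ∑' r, fractionalPoissonTerm α μ n r := by
  have hs := hasSum_fractionalPoissonTerm hα hμ
  refine nonneg_of_tsum_ofReal_eq zero_le_one
    (hs.prod_fiberwise fun j => (hs.summable.prod_factor j).hasSum) ?_ n
  simp only [← hX.measure_eq, tsum_measure_eq_one hXmeas, ENNReal.ofReal_one]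

theorem measure_natCast_sub_eq {Ω : Type*} [MeasurableSpace Ω] {P : Measure Ω} {X Y : Ω → ℕ}
    (hX : Measurable X) (hY : Measurable Y) (hXY : IndepFun X Y P) (k : ℕ) :
    P {ω | (X ω : ℤ) - (Y ω : ℤ) = k}
      = ∑' m, P {ω | X ω = k + m} * P {ω | Y ω = m} := by
  have hset : {ω | (X ω : ℤ) - (Y ω : ℤ) = k} = ⋃ m, X ⁻¹' {k + m} ∩ Y ⁻¹' {m} := by
    ext ω
    simp only [Set.mem_ofPred_eq, Set.mem_iUnion, Set.mem_inter_iff, Set.mem_preimage,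
      Set.mem_singleton_iff]
    exact ⟨fun h => ⟨Y ω, by omega, rfl⟩, fun ⟨m, hX, hY⟩ => by omega⟩
  rw [hset, measure_iUnion]
  · refine tsum_congr fun m => ?_
    exact hXY.measure_inter_preimage_eq_mul _ _ (measurableSet_singleton _)
      (measurableSet_singleton _)
  · intro a b hab
    refine Set.disjoint_left.2 fun ω ha hb => hab ?_
    exact ha.2.symm.trans hb.2
  · exact fun m => (hX (measurableSet_singleton _)).inter (hY (measurableSet_singleton _))

theorem summable_fractionalPoissonTerm_mul {α β μ₁ μ₂ : ℝ} (hα : 0 < α) (hβ : 0 < β)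
    (hμ₁ : 0 < μ₁) (hμ₂ : 0 < μ₂) (k : ℕ) :
    Summable fun p : ℕ × ℕ × ℕ =>
      fractionalPoissonTerm α μ₁ (k + p.1) p.2.1 * fractionalPoissonTerm β μ₂ p.1 p.2.2 := by
  obtain ⟨C, hC, h⟩ := exists_abs_fractionalPoissonTerm_le hα hμ₁
  obtain ⟨D, hD, h'⟩ := exists_abs_fractionalPoissonTerm_le hβ hμ₂
  have hg : Summable fun p : ℕ × ℕ × ℕ =>
      ((1 : ℝ) / 2) ^ p.1 * ((1 / 2) ^ p.2.1 * (1 / 2) ^ p.2.2) :=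
    summable_geometric_two.mul_of_nonneg summable_geometric_two_mul
      (fun _ => by positivity) (fun _ => by positivity)
  refine (hg.mul_left (C * D)).of_norm_bounded fun ⟨m, r, s⟩ => ?_
  rw [norm_mul, norm_eq_abs, norm_eq_abs]
  have hle (i : ℕ) : ((1 : ℝ) / 2) ^ i ≤ 1 := pow_le_one₀ (by norm_num) (by norm_num)
  calc |fractionalPoissonTerm α μ₁ (k + m) r| * |fractionalPoissonTerm β μ₂ m s|
      ≤ (C * ((1 / 2) ^ (k + m) * (1 / 2) ^ r)) * (D * ((1 / 2) ^ m * (1 / 2) ^ s)) :=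
        mul_le_mul (h _ _) (h' _ _) (abs_nonneg _) (by positivity)
    _ = (1 / 2) ^ k * ((1 / 2) ^ m *
          (C * D * ((1 / 2) ^ m * ((1 / 2) ^ r * (1 / 2) ^ s)))) := by rw [pow_add]; ring
    _ ≤ 1 * (1 * (C * D * ((1 / 2) ^ m * ((1 / 2) ^ r * (1 / 2) ^ s)))) := by
        gcongr <;> exact hle _
    _ = C * D * ((1 / 2) ^ m * ((1 / 2) ^ r * (1 / 2) ^ s)) := by ring

theorem hasSum_tsum_mul_tsum_fractionalPoissonTerm {α β μ₁ μ₂ : ℝ} (hα : 0 < α) (hβ : 0 < β)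
    (hμ₁ : 0 < μ₁) (hμ₂ : 0 < μ₂) (k : ℕ) :
    HasSum (fun m => (∑' r, fractionalPoissonTerm α μ₁ (k + m) r) *
        ∑' s, fractionalPoissonTerm β μ₂ m s)
      (∑' r, ∑' s, ∑' m,
        fractionalPoissonTerm α μ₁ (k + m) r * fractionalPoissonTerm β μ₂ m s) := by
  have hF := summable_fractionalPoissonTerm_mul hα hβ hμ₁ hμ₂ k
  have hX (m : ℕ) := (summable_fractionalPoissonTerm hα hμ₁).prod_factor (k + m)
  have hY (m : ℕ) := (summable_fractionalPoissonTerm hβ hμ₂).prod_factor m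
  have hswap := (Equiv.prodComm (ℕ × ℕ) ℕ).summable_iff.2 hF
  have hsum : ∑' p : ℕ × ℕ × ℕ,
      fractionalPoissonTerm α μ₁ (k + p.1) p.2.1 * fractionalPoissonTerm β μ₂ p.1 p.2.2
      = ∑' r, ∑' s, ∑' m,
        fractionalPoissonTerm α μ₁ (k + m) r * fractionalPoissonTerm β μ₂ m s := by
    rw [← (Equiv.prodComm (ℕ × ℕ) ℕ).tsum_eq]
    exact hswap.tsum_prod.trans hswap.prod.tsum_prod
  rw [← hsum]
  refine hF.hasSum.prod_fiberwise fun m => ?_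
  rw [tsum_mul_tsum_of_summable_norm (hX m).norm (hY m).norm]
  exact (hF.prod_factor m).hasSum

theorem skellam_summand_eq (α β μ₁ μ₂ : ℝ) (k r s m : ℕ) :
    μ₁ ^ k * (((-μ₁) ^ r * (-μ₂) ^ s / (r.factorial * s.factorial)) *
      ((Gamma ((k : ℝ) + r + 1 + m) * Gamma ((s : ℝ) + 1 + m) /
        (Gamma (α * ((k : ℝ) + r + m) + 1) * Gamma (β * ((s : ℝ) + m) + 1) *
          Gamma ((k : ℝ) + 1 + m))) * (μ₁ * μ₂) ^ m / m.factorial))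
      = fractionalPoissonTerm α μ₁ (k + m) r * fractionalPoissonTerm β μ₂ m s := by
  have h₁ : Gamma ((k : ℝ) + r + 1 + m) = (k + m + r).factorial := by
    rw [← Gamma_nat_eq_factorial]; push_cast; ring_nf
  have h₂ : Gamma ((s : ℝ) + 1 + m) = (m + s).factorial := by
    rw [← Gamma_nat_eq_factorial]; push_cast; ring_nf
  have h₃ : Gamma ((k : ℝ) + 1 + m) = (k + m).factorial := by
    rw [← Gamma_nat_eq_factorial]; push_cast; ring_nf
  have hα : α * ((k : ℝ) + r + m) + 1 = α * (((k + m : ℕ) : ℝ) + r) + 1 := by push_cast; ring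
  have hβ : β * ((s : ℝ) + m) + 1 = β * (m + s) + 1 := by ring
  rw [h₁, h₂, h₃, hα, hβ, fractionalPoissonTerm, fractionalPoissonTerm,
    ← Nat.add_choose_mul_factorial_mul_factorial (k + m) r,
    ← Nat.add_choose_mul_factorial_mul_factorial m s, Nat.choose_symm_add, Nat.choose_symm_add]
  push_cast
  rw [mul_pow, pow_add]
  have key (x y z w v c d A B : ℝ) {a₁ a₂ a₃ a₄ : ℝ} (h₁ : a₁ ≠ 0) (h₂ : a₂ ≠ 0) (h₃ : a₃ ≠ 0)
      (h₄ : a₄ ≠ 0) :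
      x * (y * z / (a₁ * a₂) * (c * a₄ * a₁ * (d * a₃ * a₂) / (A * B * a₄) * (w * v) / a₃))
        = c * (x * w) * y / A * (d * v * z / B) := by
    field_simp
  exact key _ _ _ _ _ _ _ _ _ (mod_cast r.factorial_ne_zero) (mod_cast s.factorial_ne_zero)
    (mod_cast m.factorial_ne_zero) (mod_cast (k + m).factorial_ne_zero)

/-- Point probabilities of the fractional two-parameter Skellam random variable
`X − Y` at nonnegative integers `n`. -/
theorem fractional_skellam_pmf_nonneg
    {Ω : Type*} [MeasurableSpace Ω] (P : Measure Ω) [IsProbabilityMeasure P]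
    (α β : ℝ) (hα : α ∈ Set.Ioo (0 : ℝ) 1) (hβ : β ∈ Set.Ioo (0 : ℝ) 1)
    (μ₁ μ₂ : ℝ) (hμ₁ : 0 < μ₁) (hμ₂ : 0 < μ₂)
    (X Y : Ω → ℕ) (hXmeas : Measurable X) (hYmeas : Measurable Y)
    (hX : IsFractionalPoisson P α μ₁ X) (hY : IsFractionalPoisson P β μ₂ Y)
    (hIndep : IndepFun X Y P) (n : ℤ) (hn : 0 ≤ n) :
    P {ω | (X ω : ℤ) - (Y ω : ℤ) = n}
      = ENNReal.ofReal (μ₁ ^ n.toNat *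
          ∑' r₁ : ℕ, ∑' r₂ : ℕ,
            ((-μ₁) ^ r₁ * (-μ₂) ^ r₂ / (r₁.factorial * r₂.factorial)) *
            ∑' m : ℕ,
              (Real.Gamma ((n : ℝ) + r₁ + 1 + m) * Real.Gamma ((r₂ : ℝ) + 1 + m) /
                (Real.Gamma (α * ((n : ℝ) + r₁ + m) + 1) *
                  Real.Gamma (β * ((r₂ : ℝ) + m) + 1) *
                  Real.Gamma ((n : ℝ) + 1 + m))) *
              (μ₁ * μ₂) ^ m / m.factorial) := by
  lift n to ℕ using hn with k
  have hnonneg₁ := hX.tsum_nonneg hα.1 hμ₁ hXmeas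
  have hnonneg₂ := hY.tsum_nonneg hβ.1 hμ₂ hYmeas
  have hsum := hasSum_tsum_mul_tsum_fractionalPoissonTerm hα.1 hβ.1 hμ₁ hμ₂ k
  rw [measure_natCast_sub_eq hXmeas hYmeas hIndep]
  simp_rw [hX.measure_eq, hY.measure_eq]
  rw [tsum_congr fun m => (ENNReal.ofReal_mul (hnonneg₁ (k + m))).symm,
    ← ENNReal.ofReal_tsum_of_nonneg (fun m => mul_nonneg (hnonneg₁ _) (hnonneg₂ _))
    hsum.summable, hsum.tsum_eq]
  simp only [Int.toNat_natCast, Int.cast_natCast]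
  rw [← tsum_mul_left]
  congr 1
  refine tsum_congr fun r => ?_
  rw [← tsum_mul_left]
  refine tsum_congr fun s => ?_
  rw [← tsum_mul_left, ← tsum_mul_left]
  exact tsum_congr fun m => (skellam_summand_eq α β μ₁ μ₂ k r s m).symm
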